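/- For every integer d ≥ 1 and every unitary U₀ ∈ U(d), the real number d − 1 is the least element of the set { Re(tr β) : β ∈ M_d, β Hermitian, and −(I ⊗ U₀ᵀ)·(SWAP − (1/d)·(I ⊗ I))·(I ⊗ U₀*) + β ⊗ I is PSD }. (This is the exact value of the SDP lower bound for unitary complex conjugation at base point U₀, reproving the tight bound d − 1.) -/

import Mathlib

open Matrix
open scoped Kronecker ComplexOrder

/-- The SWAP operator on `ℂ^d ⊗ ℂ^d`. -/
noncomputable def SwapMat (d : ℕ) : Matrix (Fin d × Fin d) (Fin d × Fin d) ℂ :=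
  Matrix.of fun p q =>
    (if p.1 = q.2 then (1 : ℂ) else 0) * (if p.2 = q.1 then (1 : ℂ) else 0)

theorem swapMat_conjTranspose (d : ℕ) : (SwapMat d)ᴴ = SwapMat d := by
  ext p q
  simp only [SwapMat, conjTranspose_apply, of_apply, star_mul', apply_ite star, star_one, star_zero]
  rw [mul_comm]
  simp only [eq_comm]

theorem swapMat_mul_apply {d : ℕ} (A : Matrix (Fin d × Fin d) (Fin d × Fin d) ℂ)
    (p q : Fin d × Fin d) : (SwapMat d * A) p q = A p.swap q := by
  rw [mul_apply, Fintype.sum_eq_single p.swap]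
  · simp [SwapMat]
  · intro r hr
    have h : ¬(p.1 = r.2 ∧ p.2 = r.1) := fun h => hr (Prod.ext h.2.symm h.1.symm)
    by_cases h1 : p.1 = r.2 <;> by_cases h2 : p.2 = r.1 <;> simp_all [SwapMat]

theorem swapMat_mul_self (d : ℕ) : SwapMat d * SwapMat d = 1 := by
  ext ⟨i, j⟩ ⟨k, l⟩
  rw [swapMat_mul_apply]
  by_cases h1 : i = k <;> by_cases h2 : j = l <;> simp [SwapMat, one_apply, h1, h2]

theorem trace_swapMat_mul_kronecker {d : ℕ} (A B : Matrix (Fin d) (Fin d) ℂ) :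
    (SwapMat d * (A ⊗ₖ B)).trace = (A * B).trace := by
  simp only [trace, diag_apply, swapMat_mul_apply, Fintype.sum_prod_type, kroneckerMap_apply]
  simp only [Matrix.mul_apply, Prod.fst_swap, Prod.snd_swap]
  rw [Finset.sum_comm]

theorem trace_swapMat (d : ℕ) : (SwapMat d).trace = d := by
  simpa using trace_swapMat_mul_kronecker (1 : Matrix (Fin d) (Fin d) ℂ) 1

theorem posSemidef_one_sub_swapMat (d : ℕ) : (1 - SwapMat d).PosSemidef := by
  have h : 1 - SwapMat d = (1 / 2 : ℂ) • ((1 - SwapMat d)ᴴ * (1 - SwapMat d)) := by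
    rw [conjTranspose_sub, conjTranspose_one, swapMat_conjTranspose, sub_mul, mul_sub, mul_sub,
      swapMat_mul_self, one_mul, mul_one, one_mul]
    module
  rw [h]
  exact (posSemidef_conjTranspose_mul_self _).smul (by norm_num [Complex.le_def])

theorem trace_one_add_swapMat_mul_nonneg {d : ℕ}
    {A : Matrix (Fin d × Fin d) (Fin d × Fin d) ℂ} (hA : A.PosSemidef) :
    0 ≤ ((1 + SwapMat d) * A).trace := by
  have h := (hA.conjTranspose_mul_mul_same (1 + SwapMat d)).trace_nonneg
  have hsq : (1 + SwapMat d) * (1 + SwapMat d) = (2 : ℂ) • (1 + SwapMat d) := by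
    rw [add_mul, mul_add, mul_add, swapMat_mul_self, one_mul, mul_one, one_mul]
    module
  rw [conjTranspose_add, conjTranspose_one, swapMat_conjTranspose, trace_mul_comm,
    ← Matrix.mul_assoc, hsq, smul_mul, trace_smul, smul_eq_mul] at h
  simpa using mul_nonneg (show (0 : ℂ) ≤ 1 / 2 by norm_num [Complex.le_def]) h

/-- Conjugating by the local unitary `1 ⊗ U*` reduces feasibility to the case `U = 1`. -/
theorem posSemidef_conj_swapMat_iff {d : ℕ} (U : Matrix.unitaryGroup (Fin d) ℂ) (c : ℂ)
    (β : Matrix (Fin d) (Fin d) ℂ) :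
    (-(((1 : Matrix (Fin d) (Fin d) ℂ) ⊗ₖ (U : Matrix (Fin d) (Fin d) ℂ)ᵀ)
        * (SwapMat d - c • ((1 : Matrix (Fin d) (Fin d) ℂ) ⊗ₖ 1))
        * ((1 : Matrix (Fin d) (Fin d) ℂ)
            ⊗ₖ ((U : Matrix (Fin d) (Fin d) ℂ).map (starRingEnd ℂ))))
      + β ⊗ₖ (1 : Matrix (Fin d) (Fin d) ℂ)).PosSemidef ↔
    (c • 1 - SwapMat d + β ⊗ₖ (1 : Matrix (Fin d) (Fin d) ℂ)).PosSemidef := by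
  set V := (U : Matrix (Fin d) (Fin d) ℂ).map (starRingEnd ℂ) with hV
  have hVH : (U : Matrix (Fin d) (Fin d) ℂ)ᵀ = Vᴴ := by
    ext i j
    simp [hV]
  have hVV : Vᴴ * V = 1 := by
    have h := congrArg transpose (UnitaryGroup.star_mul_self U)
    rw [transpose_mul, transpose_one] at h
    rw [← hVH]
    exact h
  have hW : IsUnit ((1 : Matrix (Fin d) (Fin d) ℂ) ⊗ₖ V) := by
    refine IsUnit.of_mul_eq_one_right (1 ⊗ₖ Vᴴ) ?_
    rw [← mul_kronecker_mul, hVV, Matrix.mul_one, one_kronecker_one]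
  have hWH : (1 : Matrix (Fin d) (Fin d) ℂ) ⊗ₖ Vᴴ = (1 ⊗ₖ V)ᴴ := by
    rw [conjTranspose_kronecker, conjTranspose_one]
  have hβ : β ⊗ₖ (1 : Matrix (Fin d) (Fin d) ℂ) =
      (1 ⊗ₖ V)ᴴ * (β ⊗ₖ (1 : Matrix (Fin d) (Fin d) ℂ)) * (1 ⊗ₖ V) := by
    rw [← hWH, ← mul_kronecker_mul, ← mul_kronecker_mul]
    simp [hVV]
  rw [← hW.posSemidef_star_left_conjugate_iff (x := c • 1 - SwapMat d + β ⊗ₖ 1), star_eq_conjTranspose, hVH, hWH,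
    one_kronecker_one]
  conv_lhs => rw [hβ]
  rw [← neg_sub (SwapMat d), Matrix.mul_add, Matrix.add_mul, Matrix.mul_neg,
    Matrix.neg_mul]

theorem sdp_value_unitary_conjugation (d : ℕ) (hd : 1 ≤ d)
    (U₀ : Matrix.unitaryGroup (Fin d) ℂ) :
    IsLeast { t : ℝ | ∃ β : Matrix (Fin d) (Fin d) ℂ, β.IsHermitian ∧
        (-(((1 : Matrix (Fin d) (Fin d) ℂ) ⊗ₖ (U₀ : Matrix (Fin d) (Fin d) ℂ)ᵀ)
            * (SwapMat d - ((1 : ℂ)/d) • ((1 : Matrix (Fin d) (Fin d) ℂ) ⊗ₖ 1))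
            * ((1 : Matrix (Fin d) (Fin d) ℂ)
                ⊗ₖ ((U₀ : Matrix (Fin d) (Fin d) ℂ).map (starRingEnd ℂ))))
          + β ⊗ₖ (1 : Matrix (Fin d) (Fin d) ℂ)).PosSemidef ∧
        t = (β.trace).re }
      ((d : ℝ) - 1) := by
  simp only [posSemidef_conj_swapMat_iff]
  have hd0 : (d : ℂ) ≠ 0 := Nat.cast_ne_zero.mpr (by omega)
  constructor
  · refine ⟨((1 - 1 / d : ℝ) : ℂ) • 1, ?_, ?_, ?_⟩
    · rw [IsHermitian, conjTranspose_smul, conjTranspose_one, ← starRingEnd_apply,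
        Complex.conj_ofReal]
    · convert posSemidef_one_sub_swapMat d using 1
      rw [smul_kronecker, one_kronecker_one]
      push_cast
      module
    · rw [trace_smul, trace_one, Fintype.card_fin, smul_eq_mul, ← Complex.ofReal_natCast,
        ← Complex.ofReal_mul, Complex.ofReal_re]
      have : (d : ℝ) ≠ 0 := mod_cast hd0
      field_simp
  · rintro t ⟨β, -, hβ, rfl⟩
    have h := trace_one_add_swapMat_mul_nonneg hβ
    have htr : ((1 + SwapMat d) * ((1 / d : ℂ) • 1 - SwapMat d +
        β ⊗ₖ (1 : Matrix (Fin d) (Fin d) ℂ))).trace = ((d + 1 : ℝ) : ℂ) * (β.trace - (d - 1)) := by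
      simp only [add_mul, mul_add, mul_sub, one_mul, swapMat_mul_self, trace_add, trace_sub,
        mul_smul_comm, mul_one, trace_smul, trace_swapMat, trace_swapMat_mul_kronecker,
        trace_kronecker, trace_one, Fintype.card_prod, Fintype.card_fin, smul_eq_mul]
      push_cast
      field_simp
      ring
    rw [htr] at h
    have hre := (Complex.le_def.mp h).1
    rw [Complex.re_ofReal_mul, Complex.zero_re] at hre
    have := nonneg_of_mul_nonneg_right hre (by positivity)
    simpa using this
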